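/- arXiv:1308.0615 — 3 statements merged into one kernel-verified Lean document; each statement's English description precedes it below -/
import Mathlib

section
/- Fix N ≥ 1 and let (X_j)_{j=1,…,N²} be any orthonormal basis of u(N) with respect to ⟨·,·⟩_N. Then for every N×N complex matrix A, Σ_{j=1}^{N²} X_j A X_j = −tr(A)·I, where I is the N×N identity matrix. -/
open Matrix

/-- The trace of a product of two skew-Hermitian matrices is real. -/
theorem trace_mul_im_eq_zero_of_skew {n : Type*} [Fintype n] {S T : Matrix n n ℂ}
    (hS : Sᴴ = -S) (hT : Tᴴ = -T) : (trace (S * T)).im = 0 := by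
  rw [← Complex.conj_eq_iff_im, starRingEnd_apply, ← trace_conjTranspose,
    conjTranspose_mul, hS, hT, neg_mul_neg, trace_mul_comm]

/-- A complex subspace containing every skew-Hermitian matrix is everything. -/
theorem mem_of_forall_skew_mem {n : Type*} {V : Submodule ℂ (Matrix n n ℂ)}
    (hV : ∀ Y : Matrix n n ℂ, Yᴴ = -Y → Y ∈ V) (C : Matrix n n ℂ) : C ∈ V := by
  have h₁ : C - Cᴴ ∈ V := hV _ (by simp)
  have h₂ : Complex.I • (C + Cᴴ) ∈ V := hV _ (by
    simp only [conjTranspose_smul, conjTranspose_add, conjTranspose_conjTranspose,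
      Complex.star_def, Complex.conj_I, neg_smul, add_comm])
  have h : C = (1 / 2 : ℂ) • (C - Cᴴ) + (-Complex.I / 2) • Complex.I • (C + Cᴴ) := by
    have hI : -Complex.I / 2 * Complex.I = 1 / 2 := by
      linear_combination (-1 / 2) * Complex.I_mul_I
    rw [smul_smul, hI]
    module
  rw [h]
  exact V.add_mem (V.smul_mem _ h₁) (V.smul_mem _ h₂)

/-- Expansion of an arbitrary complex matrix in an orthonormal basis of `u(N)`. -/
theorem sum_trace_mul_smul_eq {N : ℕ} {ι : Type*} [Fintype ι] [DecidableEq ι]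
    {X : ι → Matrix (Fin N) (Fin N) ℂ}
    (hskew : ∀ j, (X j)ᴴ = -X j)
    (horth : ∀ i j, (N : ℝ) * (trace ((X i)ᴴ * X j)).re = if i = j then 1 else 0)
    (hspan : ∀ Y : Matrix (Fin N) (Fin N) ℂ, Yᴴ = -Y → Y ∈ Submodule.span ℝ (Set.range X))
    (C : Matrix (Fin N) (Fin N) ℂ) :
    ∑ j, (-(N : ℂ) * trace (X j * C)) • X j = C := by
  have hX : ∀ i j, -(N : ℂ) * trace (X j * X i) = if j = i then 1 else 0 := by
    intro i j
    have h := horth j i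
    have him := trace_mul_im_eq_zero_of_skew (hskew j) (hskew i)
    rw [hskew j, neg_mul, trace_neg, Complex.neg_re] at h
    have hre : trace (X j * X i) = ((trace (X j * X i)).re : ℂ) :=
      Complex.ext (by simp) (by simp [him])
    rw [hre]
    calc -(N : ℂ) * ((trace (X j * X i)).re : ℂ)
        = (((N : ℝ) * -(trace (X j * X i)).re : ℝ) : ℂ) := by push_cast; ring
      _ = _ := by rw [h]; split_ifs <;> simp
  let V : Submodule ℂ (Matrix (Fin N) (Fin N) ℂ) :=
    { carrier := {C | ∑ j, (-(N : ℂ) * trace (X j * C)) • X j = C}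
      add_mem' := by
        intro a b ha hb
        simp only [Set.mem_ofPred_eq] at ha hb ⊢
        simp only [mul_add, trace_add, add_smul, Finset.sum_add_distrib, ha, hb]
      zero_mem' := by simp
      smul_mem' := by
        intro c a ha
        simp only [Set.mem_ofPred_eq] at ha ⊢
        conv_rhs => rw [← ha]
        simp only [mul_smul_comm, trace_smul, smul_eq_mul, Finset.smul_sum, smul_smul,
          mul_left_comm] }
  refine mem_of_forall_skew_mem (V := V) (fun Y hY => ?_) C
  have hle : Submodule.span ℝ (Set.range X) ≤ V.restrictScalars ℝ := by
    rw [Submodule.span_le]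
    rintro _ ⟨i, rfl⟩
    change ∑ j, (-(N : ℂ) * trace (X j * X i)) • X j = X i
    simp [hX]
  exact hle (hspan Y hY)

theorem magic_formula_two (N : ℕ) (hN : 1 ≤ N)
    (X : Fin (N ^ 2) → Matrix (Fin N) (Fin N) ℂ)
    (hskew : ∀ j, (X j)ᴴ = -X j)
    (horth : ∀ i j, (N : ℝ) * (Matrix.trace ((X i)ᴴ * X j)).re
      = if i = j then 1 else 0)
    (hspan : ∀ Y : Matrix (Fin N) (Fin N) ℂ, Yᴴ = -Y →
      Y ∈ Submodule.span ℝ (Set.range X))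
    (A : Matrix (Fin N) (Fin N) ℂ) :
    ∑ j, X j * A * X j
      = -((Matrix.trace A / (N : ℂ)) • (1 : Matrix (Fin N) (Fin N) ℂ)) := by
  have hN0 : (N : ℂ) ≠ 0 := by exact_mod_cast (by omega : N ≠ 0)
  have key : ∀ k p q l, ∑ j, X j k p * X j q l
      = -(if p = q ∧ k = l then (1 : ℂ) else 0) / N := by
    intro k p q l
    have h := congrFun (congrFun
      (sum_trace_mul_smul_eq hskew horth hspan (single p k 1)) q) l
    simp only [Matrix.sum_apply, Matrix.smul_apply, smul_eq_mul, trace_mul_single,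
      MulOpposite.op_one, one_smul, mul_assoc, ← Finset.mul_sum, single_apply] at h
    rw [eq_div_iff hN0, ← h]
    ring
  ext k l
  calc (∑ j, X j * A * X j) k l
      = ∑ q, ∑ p, A p q * ∑ j, X j k p * X j q l := by
        simp only [Matrix.sum_apply, Matrix.mul_apply, Finset.sum_mul, Finset.mul_sum]
        rw [Finset.sum_comm]
        refine Finset.sum_congr rfl fun q _ => ?_
        rw [Finset.sum_comm]
        refine Finset.sum_congr rfl fun p _ => Finset.sum_congr rfl fun j _ => ?_
        ring
    _ = _ := by
        simp only [key]
        by_cases hkl : k = l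
        · simp [hkl, trace, apply_ite, div_eq_mul_inv, Finset.sum_mul]
        · simp [hkl]
end

section
/- Fix N ≥ 1 and let (X_j)_{j=1,…,N²} be any orthonormal basis of u(N) with respect to ⟨·,·⟩_N. Then for all N×N complex matrices A and B, Σ_{j=1}^{N²} tr(X_j A)·tr(X_j B) = −(1/N²)·tr(AB). -/
open Matrix

/-- The trace of a product of two skew-Hermitian matrices is real. -/
lemma trace_mul_im_eq_zero_of_skewHermitian {n : Type*} [Fintype n] {X Y : Matrix n n ℂ}
    (hX : Xᴴ = -X) (hY : Yᴴ = -Y) : (trace (X * Y)).im = 0 := by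
  rw [← Complex.conj_eq_iff_im, ← Complex.star_def, ← trace_conjTranspose,
    conjTranspose_mul, hX, hY, neg_mul_neg, trace_mul_comm]

/-- Every complex matrix is `Y + i Z` with `Y` and `Z` skew-Hermitian. -/
lemma exists_skewHermitian_add_I_smul {n : Type*} (A : Matrix n n ℂ) :
    ∃ Y Z : Matrix n n ℂ, Yᴴ = -Y ∧ Zᴴ = -Z ∧ A = Y + Complex.I • Z := by
  refine ⟨(1 / 2 : ℂ) • (A - Aᴴ), (-(Complex.I / 2)) • (A + Aᴴ), ?_, ?_, ?_⟩
  · ext i j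
    simp
    ring
  · ext i j
    simp
    ring
  · ext i j
    simp
    linear_combination (A i j + starRingEnd ℂ (A j i)) / 2 * Complex.I_mul_I

/-- Completeness relation for an orthonormal spanning family of skew-Hermitian matrices. -/
lemma sum_trace_mul_trace_of_mem_span {n ι : Type*} [Fintype n] [Fintype ι] [DecidableEq ι]
    (c : ℝ) (X : ι → Matrix n n ℂ) (hskew : ∀ j, (X j)ᴴ = -X j)
    (horth : ∀ i j, c * (trace ((X i)ᴴ * X j)).re = if i = j then 1 else 0)
    (B : Matrix n n ℂ) {Y : Matrix n n ℂ} (hY : Y ∈ Submodule.span ℝ (Set.range X)) :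
    ∑ j, (c : ℂ) * trace (X j * Y) * trace (X j * B) = -trace (Y * B) := by
  induction hY using Submodule.span_induction with
  | mem Y h =>
    obtain ⟨i, rfl⟩ := h
    have key : ∀ j, (c : ℂ) * trace (X j * X i) = if j = i then -1 else 0 := by
      intro j
      have h := horth j i
      have him := trace_mul_im_eq_zero_of_skewHermitian (hskew j) (hskew i)
      rw [hskew, neg_mul, trace_neg, Complex.neg_re, mul_neg, neg_eq_iff_eq_neg] at h
      apply Complex.ext
      · rw [Complex.re_ofReal_mul, h]
        split_ifs <;> simp
      · split_ifs <;> simp [him]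
    simp [key]
  | zero => simp
  | add Y Z _ _ hY hZ =>
    simp only [mul_add, add_mul, trace_add, Finset.sum_add_distrib, hY, hZ, neg_add]
  | smul r Y _ hY =>
    simp only [trace_smul, mul_smul_comm, smul_mul_assoc, ← Finset.smul_sum, hY,
      smul_neg]

theorem magic_formula_four (N : ℕ) (hN : 1 ≤ N)
    (X : Fin (N ^ 2) → Matrix (Fin N) (Fin N) ℂ)
    (hskew : ∀ j, (X j)ᴴ = -X j)
    (horth : ∀ i j, (N : ℝ) * (Matrix.trace ((X i)ᴴ * X j)).re
      = if i = j then 1 else 0)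
    (hspan : ∀ Y : Matrix (Fin N) (Fin N) ℂ, Yᴴ = -Y →
      Y ∈ Submodule.span ℝ (Set.range X))
    (A B : Matrix (Fin N) (Fin N) ℂ) :
    ∑ j, (Matrix.trace (X j * A) / (N : ℂ)) * (Matrix.trace (X j * B) / (N : ℂ))
      = -((1 / (N : ℂ) ^ 2) * (Matrix.trace (A * B) / (N : ℂ))) := by
  have hN0 : (N : ℂ) ≠ 0 := by exact_mod_cast Nat.one_le_iff_ne_zero.mp hN
  obtain ⟨Y, Z, hY, hZ, rfl⟩ := exists_skewHermitian_add_I_smul A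
  have eY := sum_trace_mul_trace_of_mem_span N X hskew horth B (hspan Y hY)
  have eZ := sum_trace_mul_trace_of_mem_span N X hskew horth B (hspan Z hZ)
  have expand : ∀ j, trace (X j * (Y + Complex.I • Z)) / (N : ℂ) * (trace (X j * B) / (N : ℂ))
      = 1 / (N : ℂ) ^ 3 * (((N : ℝ) : ℂ) * trace (X j * Y) * trace (X j * B))
        + Complex.I / (N : ℂ) ^ 3 * (((N : ℝ) : ℂ) * trace (X j * Z) * trace (X j * B)) := by
    intro j
    simp only [mul_add, Matrix.mul_smul, trace_add, trace_smul, smul_eq_mul,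
      Complex.ofReal_natCast]
    field_simp
  rw [Finset.sum_congr rfl fun j _ => expand j, Finset.sum_add_distrib, ← Finset.mul_sum,
    ← Finset.mul_sum, eY, eZ]
  simp only [add_mul, Matrix.smul_mul, trace_add, trace_smul, smul_eq_mul]
  field_simp
  ring
end

section
/- Let N ≥ 1, let A₀ ∈ U(N), and let C = { V A₀ V⁻¹ : V ∈ U(N) } be its conjugacy class. Suppose f : C → M_N(ℂ) is conjugation equivariant, i.e., f(V B V⁻¹) = V f(B) V⁻¹ for all B ∈ C and all V ∈ U(N). Then there exists a polynomial p ∈ ℂ[X] in a single variable such that f(B) = p(B) for all B ∈ C, where p(B) denotes the evaluation of p at the matrix B. -/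
open Matrix

/-- Polynomial evaluation preserves intertwining relations. -/
theorem aeval_mul_eq_mul_aeval_of_intertwine {R S : Type*} [CommSemiring R] [Semiring S]
    [Algebra R S] {x y v : S} (h : x * v = v * y) (p : Polynomial R) :
    Polynomial.aeval x p * v = v * Polynomial.aeval y p := by
  have hpow (n : ℕ) : x ^ n * v = v * y ^ n :=
    (SemiconjBy.pow_right (show SemiconjBy v y x from h.symm) n).eq.symm
  induction p using Polynomial.induction_on' with
  | add p q hp hq => simp [add_mul, mul_add, hp, hq]
  | monomial n a =>
    simp only [Polynomial.aeval_monomial]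
    rw [mul_assoc, hpow, ← mul_assoc, Algebra.commutes, mul_assoc]

/-- A linear endomorphism for which every vector of a subspace is an eigenvector acts on that
subspace as a scalar. -/
theorem exists_smul_of_forall_exists_smul {K E : Type*} [Field K] [AddCommGroup E] [Module K E]
    (g : E →ₗ[K] E) (W : Submodule K E) (h : ∀ v ∈ W, ∃ c : K, g v = c • v) :
    ∃ c : K, ∀ v ∈ W, g v = c • v := by
  by_cases hW : ∃ v ∈ W, v ≠ 0
  · obtain ⟨v, hv, hv0⟩ := hW
    obtain ⟨c, hc⟩ := h v hv
    refine ⟨c, fun w hw => ?_⟩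
    obtain ⟨d, hd⟩ := h w hw
    obtain ⟨e, he⟩ := h (v + w) (W.add_mem hv hw)
    rw [map_add, hc, hd, smul_add] at he
    have key : (d - e) • w = (e - c) • v := by
      rw [sub_smul, sub_smul, sub_eq_sub_iff_add_eq_add, add_comm, he]
    by_cases hde : d - e = 0
    · rw [hde, zero_smul, eq_comm, smul_eq_zero] at key
      have hec := key.resolve_right hv0
      rw [hd, sub_eq_zero.mp hde, sub_eq_zero.mp hec]
    · have hw' : w = ((d - e)⁻¹ * (e - c)) • v := by
        rw [mul_smul, ← key, inv_smul_smul₀ hde]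
      rw [hw', map_smul, hc, smul_comm]
  · push Not at hW
    exact ⟨0, fun v hv => by simp [hW v hv]⟩

namespace Matrix

open scoped ComplexOrder

variable {n : Type*} [Fintype n]

theorem conjTranspose_mulVec_eq_zero_of_commute {T : Matrix n n ℂ} (hT : Tᴴ * T = T * Tᴴ)
    {v : n → ℂ} (hv : T *ᵥ v = 0) : Tᴴ *ᵥ v = 0 := by
  rw [← self_mul_conjTranspose_mulVec_eq_zero, ← hT, ← mulVec_mulVec, hv, mulVec_zero]

variable [DecidableEq n]

theorem mulVec_eq_zero_of_pow_mulVec_eq_zero {T : Matrix n n ℂ} (hT : Tᴴ * T = T * Tᴴ)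
    (k : ℕ) {v : n → ℂ} (hv : T ^ k *ᵥ v = 0) : T *ᵥ v = 0 := by
  induction k with
  | zero =>
    rw [pow_zero, one_mulVec] at hv
    rw [hv, mulVec_zero]
  | succ k ih =>
    cases k with
    | zero => simpa using hv
    | succ k =>
      refine ih ?_
      rw [pow_succ', ← mulVec_mulVec]
      rw [pow_succ', pow_succ', ← mulVec_mulVec, ← mulVec_mulVec] at hv
      rw [← conjTranspose_mul_self_mulVec_eq_zero, ← mulVec_mulVec]
      exact conjTranspose_mulVec_eq_zero_of_commute hT hv

theorem conjTranspose_mul_self_sub_scalar {A : Matrix n n ℂ} (hA : Aᴴ * A = A * Aᴴ) (μ : ℂ) :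
    (A - μ • 1)ᴴ * (A - μ • 1) = (A - μ • 1) * (A - μ • 1)ᴴ := by
  simp only [conjTranspose_sub, conjTranspose_smul, conjTranspose_one, sub_mul, mul_sub, hA,
    smul_mul_assoc, mul_smul_comm, one_mul, mul_one, smul_sub, smul_comm μ (star μ)]
  abel

/-- A normal complex matrix is diagonalizable. -/
theorem iSup_eigenspace_toLin'_eq_top {A : Matrix n n ℂ} (hA : Aᴴ * A = A * Aᴴ) :
    ⨆ μ : ℂ, Module.End.eigenspace (toLin' A) μ = ⊤ := by
  rw [eq_top_iff, ← Module.End.iSup_maxGenEigenspace_eq_top (toLin' A)]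
  refine iSup_mono fun μ v hv => ?_
  obtain ⟨k, hk⟩ := Module.End.mem_maxGenEigenspace _ _ _ |>.mp hv
  have hlin : toLin' A - μ • 1 = toLin' (A - μ • 1) := by
    rw [map_sub, map_smul, toLin'_one]; rfl
  rw [hlin, ← toLin'_pow, toLin'_apply] at hk
  have := mulVec_eq_zero_of_pow_mulVec_eq_zero (conjTranspose_mul_self_sub_scalar hA μ) k hk
  rw [Module.End.mem_eigenspace_iff, toLin'_apply]
  rwa [sub_mulVec, smul_mulVec, one_mulVec, sub_eq_zero] at this

/-- If `M` commutes with every unitary commuting with a normal matrix `A`, then every eigenvector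
of `A` is an eigenvector of `M`: apply the hypothesis to the reflection along that vector. -/
theorem exists_mulVec_eq_smul_of_commute_unitary {A M : Matrix n n ℂ} (hA : Aᴴ * A = A * Aᴴ)
    (hM : ∀ V ∈ unitaryGroup n ℂ, V * A = A * V → V * M = M * V)
    {μ : ℂ} {v : n → ℂ} (hv : A *ᵥ v = μ • v) : ∃ c : ℂ, M *ᵥ v = c • v := by
  by_cases hv0 : v = 0
  · exact ⟨0, by simp [hv0]⟩
  have hs : star v ⬝ᵥ v ≠ 0 := by rwa [Ne, dotProduct_star_self_eq_zero]
  set s := star v ⬝ᵥ v with hs_def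
  have hstar : star s = s := by
    rw [hs_def, ← star_dotProduct_star, star_star]
  have hAv : Aᴴ *ᵥ v = star μ • v := by
    have := conjTranspose_mulVec_eq_zero_of_commute (conjTranspose_mul_self_sub_scalar hA μ)
      (v := v) (by rw [sub_mulVec, smul_mulVec, one_mulVec, hv, sub_self])
    rwa [conjTranspose_sub, conjTranspose_smul, conjTranspose_one, sub_mulVec, smul_mulVec,
      one_mulVec, sub_eq_zero] at this
  have hvA : star v ᵥ* A = μ • star v := by
    have := congrArg star hAv
    rwa [star_mulVec, conjTranspose_conjTranspose, star_smul, star_star] at this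
  set P := vecMulVec v (star v) with hP
  have hPP : P * P = s • P := by
    rw [hP, vecMulVec_mul_vecMulVec, ← hs_def, vecMulVec_smul]
  have hPH : star P = P := by
    rw [star_eq_conjTranspose, hP, conjTranspose_vecMulVec, star_star]
  have hPA : P * A = A * P := by
    rw [hP, vecMulVec_mul, mul_vecMulVec, hvA, hv, vecMulVec_smul, smul_vecMulVec]
  have hV : 1 - (2 / s) • P ∈ unitaryGroup n ℂ := by
    rw [mem_unitaryGroup_iff, star_sub, star_one, star_smul, hPH, star_div₀, hstar]
    simp only [sub_mul, mul_sub, one_mul, mul_one, smul_mul_assoc, mul_smul_comm, hPP, smul_sub,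
      smul_smul]
    rw [show star (2 : ℂ) = 2 by simp]
    have : 2 / s * (2 / s * s) = 2 / s + 2 / s := by field_simp; norm_num
    rw [this, add_smul]
    abel
  have hPM := hM _ hV (by
    rw [sub_mul, mul_sub, one_mul, mul_one, smul_mul_assoc, mul_smul_comm, hPA])
  rw [sub_mul, mul_sub, one_mul, mul_one, smul_mul_assoc, mul_smul_comm, sub_right_inj] at hPM
  replace hPM := smul_right_injective _ (div_ne_zero two_ne_zero hs) hPM
  have hPv (w : n → ℂ) : P *ᵥ w = (star v ⬝ᵥ w) • v := by
    rw [hP, vecMulVec_mulVec, op_smul_eq_smul]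
  have h := congrArg (· *ᵥ v) hPM
  simp only [← mulVec_mulVec, hPv, mulVec_smul] at h
  refine ⟨s⁻¹ * (star v ⬝ᵥ M *ᵥ v), ?_⟩
  rw [mul_smul, h, inv_smul_smul₀ hs]

/-- A matrix commuting with every unitary that commutes with a normal matrix `A` is a polynomial
in `A`. -/
theorem exists_eq_aeval_of_commute_unitary {A M : Matrix n n ℂ} (hA : Aᴴ * A = A * Aᴴ)
    (hM : ∀ V ∈ unitaryGroup n ℂ, V * A = A * V → V * M = M * V) :
    ∃ p : Polynomial ℂ, M = Polynomial.aeval A p := by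
  have hscalar (μ : ℂ) : ∃ c : ℂ, ∀ v ∈ Module.End.eigenspace (toLin' A) μ,
      toLin' M v = c • v := by
    refine exists_smul_of_forall_exists_smul _ _ fun v hv => ?_
    exact exists_mulVec_eq_smul_of_commute_unitary hA hM (Module.End.mem_eigenspace_iff.mp hv)
  choose c hc using hscalar
  have hfin : {μ : ℂ | Module.End.HasEigenvalue (toLin' A) μ}.Finite :=
    Module.End.finite_hasEigenvalue (toLin' A)
  refine ⟨Lagrange.interpolate hfin.toFinset id c, ?_⟩
  apply toLin'.injective
  have haeval (p : Polynomial ℂ) : toLin' (Polynomial.aeval A p) = p.aeval (toLin' A) :=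
    (Polynomial.aeval_algHom_apply (toLinAlgEquiv' : Matrix n n ℂ ≃ₐ[ℂ] _) A p).symm
  rw [haeval, ← sub_eq_zero, ← LinearMap.ker_eq_top, eq_top_iff,
    ← iSup_eigenspace_toLin'_eq_top hA]
  refine iSup_le fun μ v hv => ?_
  rw [LinearMap.mem_ker, LinearMap.sub_apply, sub_eq_zero, hc μ v hv]
  by_cases hv0 : v = 0
  · simp [hv0]
  have hvec : Module.End.HasEigenvector (toLin' A) μ v := ⟨hv, hv0⟩
  have hμ : μ ∈ hfin.toFinset := by
    simpa using Module.End.hasEigenvalue_of_hasEigenvector hvec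
  rw [Module.End.aeval_apply_of_hasEigenvector hvec]
  congr 1
  exact (Lagrange.eval_interpolate_at_node c (v := id) Function.injective_id.injOn hμ).symm

end Matrix

theorem conjugation_equivariant_is_polynomial (N : ℕ) (hN : 1 ≤ N)
    (A₀ : Matrix (Fin N) (Fin N) ℂ) (hA₀ : A₀ ∈ Matrix.unitaryGroup (Fin N) ℂ)
    (f : Matrix (Fin N) (Fin N) ℂ → Matrix (Fin N) (Fin N) ℂ)
    (hf : ∀ B ∈ {B | ∃ V ∈ Matrix.unitaryGroup (Fin N) ℂ, B = V * A₀ * V⁻¹},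
      ∀ V ∈ Matrix.unitaryGroup (Fin N) ℂ, f (V * B * V⁻¹) = V * f B * V⁻¹) :
    ∃ p : Polynomial ℂ,
      ∀ B ∈ {B | ∃ V ∈ Matrix.unitaryGroup (Fin N) ℂ, B = V * A₀ * V⁻¹},
        f B = Polynomial.aeval B p := by
  have hinv {V : Matrix (Fin N) (Fin N) ℂ} (hV : V ∈ Matrix.unitaryGroup (Fin N) ℂ) :
      V⁻¹ * V = 1 := by
    rw [Matrix.inv_eq_left_inv (Matrix.mem_unitaryGroup_iff'.mp hV)]
    exact Matrix.mem_unitaryGroup_iff'.mp hV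
  have hinv' {V : Matrix (Fin N) (Fin N) ℂ} (hV : V ∈ Matrix.unitaryGroup (Fin N) ℂ) :
      V * V⁻¹ = 1 := mul_eq_one_comm.mp (hinv hV)
  have hmem : A₀ ∈ {B | ∃ V ∈ Matrix.unitaryGroup (Fin N) ℂ, B = V * A₀ * V⁻¹} :=
    ⟨1, one_mem _, by simp⟩
  obtain ⟨p, hp⟩ := Matrix.exists_eq_aeval_of_commute_unitary (A := A₀) (M := f A₀)
    ((Matrix.mem_unitaryGroup_iff'.mp hA₀).trans (Matrix.mem_unitaryGroup_iff.mp hA₀).symm)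
    (fun V hV hcomm => by
      have h := hf A₀ hmem V hV
      rw [hcomm, mul_assoc, hinv' hV, mul_one] at h
      nth_rewrite 2 [h]
      rw [mul_assoc, hinv hV, mul_one])
  refine ⟨p, ?_⟩
  rintro B ⟨V, hV, rfl⟩
  rw [hf A₀ hmem V hV, hp, ← aeval_mul_eq_mul_aeval_of_intertwine (x := V * A₀ * V⁻¹)
    (by rw [mul_assoc, hinv hV, mul_one]), mul_assoc, hinv' hV, mul_one]
end
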